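/- Let $\mu$ be a symmetric, finitely supported, aperiodic probability measure on $\mathbb{Z}$ whose support generates the group $\mathbb{Z}$. Here symmetric means $\mu(x)=\mu(-x)$ for all $x$, aperiodic means $\gcd\{n\ge 1:\mu^{*n}(0)>0\}=1$, and $\mu^{*n}$ denotes the $n$-fold convolution power of $\mu$. For every $\varepsilon>0$ there exists $K>0$ such that for all sufficiently large $n$ and every integer $T$ with $\sqrt n\le T\le n^{2/3}$, it holds that $\mu^{*n}(T+\lfloor Kn/T\rfloor)\le\varepsilon\,\mu^{*n}(T)$. -/

import Mathlib

/-- Convolution of two functions on `ℤ`: `(μ * ν)(x) = Σ_y μ(y) ν(x - y)`. -/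
noncomputable def convZ (μ ν : ℤ → ℝ) : ℤ → ℝ := fun x => ∑' y : ℤ, μ y * ν (x - y)

/-- `n`-fold convolution power on `ℤ`; `convZPow μ 0` is the point mass at `0`. -/
noncomputable def convZPow (μ : ℤ → ℝ) : ℕ → ℤ → ℝ
  | 0 => fun x => if x = 0 then 1 else 0
  | n + 1 => convZ μ (convZPow μ n)

/-- The greatest common divisor of the return times `{n ≥ 1 : μ^{*n}(0) > 0}` is `1`:
the only common divisor of all of them is `1`. (If there were no return times, `d = 0` would be
a common divisor, so the condition fails in that case.) -/
def AperiodicZ (μ : ℤ → ℝ) : Prop :=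
  ∀ d : ℕ, (∀ n : ℕ, 1 ≤ n → 0 < convZPow μ n 0 → d ∣ n) → d = 1

/-- The support of `μ` generates the group `ℤ`. For symmetric `μ` this is the same as generating
`ℤ` as a semigroup, that is, irreducibility of the random walk. -/
def NondegenerateZ (μ : ℤ → ℝ) : Prop :=
  AddSubgroup.closure (Function.support μ) = ⊤

open Complex in
/-- The Fourier transform `θ ↦ Σ_{s ∈ S} p(s) e^{iθs}` of a function supported on `S`. -/
noncomputable def charSum (S : Finset ℤ) (p : ℤ → ℝ) (θ : ℝ) : ℂ :=
  ∑ s ∈ S, (p s : ℂ) * Complex.exp (θ * s * I)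

theorem continuous_charSum (S : Finset ℤ) (p : ℤ → ℝ) : Continuous (charSum S p) := by
  unfold charSum
  fun_prop

theorem convZ_eq_sum {S : Finset ℤ} {p : ℤ → ℝ} (hS : ∀ x ∉ S, p x = 0) (q : ℤ → ℝ) (x : ℤ) :
    convZ p q x = ∑ y ∈ S, p y * q (x - y) :=
  tsum_eq_sum fun y hy => by rw [hS y hy, zero_mul]

theorem integral_exp_int_mul_I (x : ℤ) :
    ∫ θ in (-Real.pi)..Real.pi, Complex.exp (-(θ * x * Complex.I)) =
      if x = 0 then (2 * Real.pi : ℂ) else 0 := by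
  split_ifs with h
  · subst h
    simp
    ring
  · have hc : (-(x * Complex.I) : ℂ) ≠ 0 := by simp [h]
    have h1 : ∀ θ : ℝ, Complex.exp (-(θ * x * Complex.I)) =
        Complex.exp (-(x * Complex.I) * θ) := fun θ => by ring_nf
    simp_rw [h1]
    rw [integral_exp_mul_complex hc]
    have : Complex.exp (-(x * Complex.I) * (Real.pi : ℝ)) =
        Complex.exp (-(x * Complex.I) * ((-Real.pi : ℝ) : ℂ)) := by
      rw [Complex.exp_eq_exp_iff_exists_int]
      refine ⟨-x, ?_⟩
      push_cast
      ring
    rw [this, sub_self, zero_div]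

/-- Fourier inversion for convolution powers of a finitely supported function on `ℤ`. -/
theorem convZPow_eq_integral {S : Finset ℤ} {p : ℤ → ℝ} (hS : ∀ x ∉ S, p x = 0) (n : ℕ) (x : ℤ) :
    (2 * Real.pi : ℂ) * (convZPow p n x : ℂ) =
      ∫ θ in (-Real.pi)..Real.pi, charSum S p θ ^ n * Complex.exp (-(θ * x * Complex.I)) := by
  induction n generalizing x with
  | zero =>
    simp only [pow_zero, one_mul, integral_exp_int_mul_I, convZPow]
    split_ifs <;> simp
  | succ n ih =>
    have hcont : ∀ y : ℤ, Continuous fun θ : ℝ =>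
        (p y : ℂ) * (charSum S p θ ^ n * Complex.exp (-(θ * ((x - y : ℤ) : ℂ) * Complex.I))) := by
      intro y
      have := continuous_charSum S p
      fun_prop
    have h1 : ∀ θ : ℝ, charSum S p θ ^ (n + 1) * Complex.exp (-(θ * x * Complex.I)) =
        ∑ y ∈ S, (p y : ℂ) *
          (charSum S p θ ^ n * Complex.exp (-(θ * ((x - y : ℤ) : ℂ) * Complex.I))) := by
      intro θ
      have h2 : ∀ y : ℤ, Complex.exp (-(θ * ((x - y : ℤ) : ℂ) * Complex.I)) =
          Complex.exp (θ * y * Complex.I) * Complex.exp (-(θ * x * Complex.I)) := by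
        intro y
        rw [← Complex.exp_add]
        push_cast
        ring_nf
      rw [pow_succ]
      nth_rewrite 2 [charSum]
      rw [Finset.mul_sum, Finset.sum_mul]
      refine Finset.sum_congr rfl fun y _ => ?_
      rw [h2]
      ring
    simp_rw [h1]
    rw [intervalIntegral.integral_finsetSum
      fun y _ => (hcont y).intervalIntegrable _ _]
    simp_rw [intervalIntegral.integral_const_mul, ← ih]
    rw [convZPow, convZ_eq_sum hS]
    push_cast
    rw [Finset.mul_sum]
    exact Finset.sum_congr rfl fun y _ => by ring

/-- Exponential tilting commutes with convolution powers. -/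
theorem convZPow_tilt {S : Finset ℤ} {μ : ℤ → ℝ} (hS : ∀ x ∉ S, μ x = 0) (l Z : ℝ)
    (n : ℕ) (x : ℤ) :
    convZPow (fun x => μ x * Real.exp (l * x) / Z) n x =
      Real.exp (l * x) / Z ^ n * convZPow μ n x := by
  induction n generalizing x with
  | zero =>
    simp only [convZPow]
    split_ifs with h <;> simp [h]
  | succ n ih =>
    rw [convZPow, convZPow, convZ_eq_sum (S := S) (fun x hx => by simp [hS x hx]),
      convZ_eq_sum hS, Finset.mul_sum]
    refine Finset.sum_congr rfl fun y _ => ?_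
    have : Real.exp (l * x) = Real.exp (l * y) * Real.exp (l * ((x - y : ℤ) : ℝ)) := by
      rw [← Real.exp_add]
      push_cast
      ring_nf
    rw [ih, this, pow_succ]
    ring

theorem integral_exp_neg_mul_sq_le_sqrt {k : ℝ} (hk : 0 < k) :
    ∫ θ in (-Real.pi)..Real.pi, Real.exp (-k * θ ^ 2) ≤ Real.sqrt (Real.pi / k) := by
  rw [← integral_gaussian, intervalIntegral.integral_of_le (by linarith [Real.pi_pos])]
  exact MeasureTheory.setIntegral_le_integral (integrable_exp_neg_mul_sq hk)
    (Filter.Eventually.of_forall fun x => (Real.exp_pos _).le)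

theorem pow_three_mul_exp_neg_sq_le (t : ℝ) : t ^ 3 * Real.exp (-t ^ 2) ≤ 1 := by
  have h := Real.quadratic_le_exp_of_nonneg (sq_nonneg t)
  rw [Real.exp_neg, ← div_eq_mul_inv, div_le_one (Real.exp_pos _)]
  nlinarith [sq_nonneg (t ^ 2 - t), sq_nonneg t, sq_nonneg (t-1)]

/-- The truncated third absolute moment of a Gaussian weight. -/
theorem integral_abs_pow_three_mul_exp_le {k : ℝ} (hk : 0 < k) :
    ∫ θ in (-Real.pi)..Real.pi, |θ| ^ 3 * Real.exp (-(2 * k) * θ ^ 2) ≤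
      Real.sqrt Real.pi / k ^ 2 := by
  have hpi := Real.pi_pos
  have hs : 0 < Real.sqrt k := Real.sqrt_pos.2 hk
  have hss : Real.sqrt k ^ 2 = k := Real.sq_sqrt hk.le
  calc ∫ θ in (-Real.pi)..Real.pi, |θ| ^ 3 * Real.exp (-(2 * k) * θ ^ 2)
      ≤ ∫ θ in (-Real.pi)..Real.pi, (Real.sqrt k ^ 3)⁻¹ * Real.exp (-k * θ ^ 2) := by
        refine intervalIntegral.integral_mono_on (by linarith)
          (Continuous.intervalIntegrable (by fun_prop) _ _)
          (Continuous.intervalIntegrable (by fun_prop) _ _) fun θ _ => ?_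
        have h := pow_three_mul_exp_neg_sq_le (Real.sqrt k * |θ|)
        rw [mul_pow, mul_pow, hss, sq_abs] at h
        have h2 : Real.exp (-(2 * k) * θ ^ 2) =
            Real.exp (-(k * θ ^ 2)) * Real.exp (-k * θ ^ 2) := by
          rw [← Real.exp_add]; ring_nf
        rw [h2, ← mul_assoc]
        refine mul_le_mul_of_nonneg_right ?_ (Real.exp_pos _).le
        rw [← one_div, le_div_iff₀ (by positivity)]
        linarith
    _ = (Real.sqrt k ^ 3)⁻¹ * ∫ θ in (-Real.pi)..Real.pi, Real.exp (-k * θ ^ 2) :=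
        intervalIntegral.integral_const_mul _ _
    _ ≤ (Real.sqrt k ^ 3)⁻¹ * Real.sqrt (Real.pi / k) := by
        gcongr
        exact integral_exp_neg_mul_sq_le_sqrt hk
    _ = _ := by
        rw [Real.sqrt_div hpi.le]
        have : k ^ 2 = Real.sqrt k ^ 3 * Real.sqrt k := by 
          rw [← pow_succ, show 3 + 1 = 2 * 2 from rfl, pow_mul, hss]
        rw [this]
        field_simp

theorem norm_pow_succ_sub_pow_succ_le {a b : ℂ} {r : ℝ} (ha : ‖a‖ ≤ r) (hb : ‖b‖ ≤ r) (n : ℕ) :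
    ‖a ^ (n + 1) - b ^ (n + 1)‖ ≤ (n + 1) * ‖a - b‖ * r ^ n := by
  have hr : 0 ≤ r := (norm_nonneg a).trans ha
  induction n with
  | zero => simp
  | succ n ih =>
    have h : a ^ (n + 1 + 1) - b ^ (n + 1 + 1) =
        a * (a ^ (n + 1) - b ^ (n + 1)) + (a - b) * b ^ (n + 1) := by ring
    calc ‖a ^ (n + 1 + 1) - b ^ (n + 1 + 1)‖
        ≤ ‖a‖ * ‖a ^ (n + 1) - b ^ (n + 1)‖ + ‖a - b‖ * ‖b‖ ^ (n + 1) := by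
          rw [h, ← norm_pow, ← norm_mul, ← norm_mul]
          exact norm_add_le _ _
      _ ≤ r * ((n + 1) * ‖a - b‖ * r ^ n) + ‖a - b‖ * r ^ (n + 1) := by gcongr
      _ = _ := by push_cast; ring

/-- Second order Taylor expansion of `e^{iu}`. -/
theorem norm_exp_mul_I_sub_le (u : ℝ) :
    ‖Complex.exp (u * Complex.I) - (1 + u * Complex.I - u ^ 2 / 2)‖ ≤
      |u| ^ 3 * Real.exp |u| := by
  have h := Complex.norm_exp_sub_sum_le_norm_mul_exp (u * Complex.I) 3
  have h2 : ∑ m ∈ Finset.range 3, (u * Complex.I) ^ m / (m.factorial : ℂ) =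
      1 + u * Complex.I - u ^ 2 / 2 := by
    simp [Finset.sum_range_succ, mul_pow]
    ring
  rw [h2] at h
  simpa using h

/-- First order Taylor expansion of `e^{-w}`. -/
theorem norm_exp_neg_sub_le {w : ℝ} (hw : 0 ≤ w) :
    ‖Complex.exp (-w) - (1 - w)‖ ≤ w ^ 2 * Real.exp w := by
  have h := Complex.norm_exp_sub_sum_le_norm_mul_exp (-w : ℂ) 2
  have h2 : ∑ m ∈ Finset.range 2, (-w : ℂ) ^ m / (m.factorial : ℂ) = 1 - w := by
    simp [Finset.sum_range_succ]
    ring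
  rw [h2] at h
  simpa [abs_of_nonneg hw] using h

theorem nonneg_of_sum_eq_one {S : Finset ℤ} {R : ℝ} (hR : ∀ s ∈ S, |(s : ℝ)| ≤ R)
    {p : ℤ → ℝ} (h1 : ∑ s ∈ S, p s = 1) : 0 ≤ R := by
  rcases S.eq_empty_or_nonempty with rfl | ⟨s, hs⟩
  · simp at h1
  · exact (abs_nonneg _).trans (hR s hs)

theorem abs_sub_mean_le {S : Finset ℤ} {R : ℝ} (hR : ∀ s ∈ S, |(s : ℝ)| ≤ R)
    {p : ℤ → ℝ} (h0 : ∀ x, 0 ≤ p x) (h1 : ∑ s ∈ S, p s = 1) {m : ℝ}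
    (hm : ∑ s ∈ S, p s * s = m) : ∀ s ∈ S, |(s : ℝ) - m| ≤ 2 * R := by
  have hmR : |m| ≤ R := by
    rw [← hm]
    calc |∑ s ∈ S, p s * (s : ℝ)| ≤ ∑ s ∈ S, |p s * (s : ℝ)| := Finset.abs_sum_le_sum_abs _ _
      _ ≤ ∑ s ∈ S, p s * R := by
          refine Finset.sum_le_sum fun s hs => ?_
          rw [abs_mul, abs_of_nonneg (h0 s)]
          exact mul_le_mul_of_nonneg_left (hR s hs) (h0 s)
      _ = R := by rw [← Finset.sum_mul, h1, one_mul]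
  exact fun s hs => (abs_sub _ _).trans (by linarith [hR s hs])

theorem variance_le {S : Finset ℤ} {R : ℝ} (hR : ∀ s ∈ S, |(s : ℝ)| ≤ R)
    {p : ℤ → ℝ} (h0 : ∀ x, 0 ≤ p x) (h1 : ∑ s ∈ S, p s = 1) {m : ℝ}
    (hm : ∑ s ∈ S, p s * s = m) : ∑ s ∈ S, p s * ((s : ℝ) - m) ^ 2 ≤ 4 * R ^ 2 := by
  calc ∑ s ∈ S, p s * ((s : ℝ) - m) ^ 2 ≤ ∑ s ∈ S, p s * (4 * R ^ 2) := by
        refine Finset.sum_le_sum fun s hs => mul_le_mul_of_nonneg_left ?_ (h0 s)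
        rw [← sq_abs]
        nlinarith [abs_sub_mean_le hR h0 h1 hm s hs, abs_nonneg ((s : ℝ) - m)]
    _ = 4 * R ^ 2 := by rw [← Finset.sum_mul, h1, one_mul]

/-- A centred characteristic function is close to that of the Gaussian with the same variance. -/
theorem norm_charSum_sub_gaussian_le {S : Finset ℤ} {R : ℝ} (hR : ∀ s ∈ S, |(s : ℝ)| ≤ R)
    {p : ℤ → ℝ} (h0 : ∀ x, 0 ≤ p x) (h1 : ∑ s ∈ S, p s = 1) {m v : ℝ}
    (hm : ∑ s ∈ S, p s * s = m) (hv : ∑ s ∈ S, p s * ((s : ℝ) - m) ^ 2 = v)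
    {θ : ℝ} (hθ : |θ| ≤ Real.pi) :
    ‖charSum S p θ * Complex.exp (-(θ * m * Complex.I)) - Complex.exp (-(v * θ ^ 2 / 2 : ℝ))‖ ≤
      (8 * R ^ 3 * Real.exp (2 * R * Real.pi) +
        4 * R ^ 4 * Real.pi * Real.exp (2 * R ^ 2 * Real.pi ^ 2)) * |θ| ^ 3 := by
  have hpi := Real.pi_pos
  have hR0 := nonneg_of_sum_eq_one hR h1
  have hsm := abs_sub_mean_le hR h0 h1 hm
  have hvR := variance_le hR h0 h1 hm
  rw [hv] at hvR
  have hv0 : 0 ≤ v := by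
    rw [← hv]
    exact Finset.sum_nonneg fun s _ => mul_nonneg (h0 s) (sq_nonneg _)
  have hcs : charSum S p θ * Complex.exp (-(θ * m * Complex.I)) =
      ∑ s ∈ S, (p s : ℂ) * Complex.exp ((θ * (s - m) : ℝ) * Complex.I) := by
    rw [charSum, Finset.sum_mul]
    refine Finset.sum_congr rfl fun s _ => ?_
    rw [mul_assoc, ← Complex.exp_add]
    push_cast
    ring_nf
  have hpoly : ∑ s ∈ S, (p s : ℂ) * (1 + ((θ * (s - m) : ℝ) : ℂ) * Complex.I -
      ((θ * (s - m) : ℝ) : ℂ) ^ 2 / 2) = 1 - ((v * θ ^ 2 / 2 : ℝ) : ℂ) := by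
    have h1c : ∑ s ∈ S, (p s : ℂ) = 1 := by exact_mod_cast h1
    have hmc : ∑ s ∈ S, (p s : ℂ) * s = m := by exact_mod_cast hm
    have hvc : ∑ s ∈ S, (p s : ℂ) * ((s : ℂ) - m) ^ 2 = v := by exact_mod_cast hv
    have : ∀ s : ℤ, (p s : ℂ) * (1 + ((θ * (s - m) : ℝ) : ℂ) * Complex.I -
        ((θ * (s - m) : ℝ) : ℂ) ^ 2 / 2) = p s + θ * Complex.I * (p s * s) -
          θ * Complex.I * m * p s - θ ^ 2 / 2 * (p s * ((s : ℂ) - m) ^ 2) := by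
      intro s
      push_cast
      ring
    simp_rw [this, Finset.sum_sub_distrib, Finset.sum_add_distrib, ← Finset.mul_sum, h1c, hmc, hvc]
    push_cast
    ring
  have hA : ‖charSum S p θ * Complex.exp (-(θ * m * Complex.I)) - (1 - (v * θ ^ 2 / 2 : ℝ))‖ ≤
      8 * R ^ 3 * Real.exp (2 * R * Real.pi) * |θ| ^ 3 := by
    rw [← hpoly, hcs, ← Finset.sum_sub_distrib]
    calc _ ≤ ∑ s ∈ S, p s * (8 * R ^ 3 * Real.exp (2 * R * Real.pi) * |θ| ^ 3) := by
          refine norm_sum_le_of_le _ fun s hs => ?_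
          rw [← mul_sub, norm_mul, Complex.norm_real, Real.norm_of_nonneg (h0 s)]
          refine mul_le_mul_of_nonneg_left ((norm_exp_mul_I_sub_le _).trans ?_) (h0 s)
          have hu : |θ * (s - m)| ≤ |θ| * (2 * R) := by
            rw [abs_mul]
            exact mul_le_mul_of_nonneg_left (hsm s hs) (abs_nonneg _)
          have hu2 : |θ * (s - m)| ≤ 2 * R * Real.pi := hu.trans (by nlinarith)
          calc _ ≤ (|θ| * (2 * R)) ^ 3 * Real.exp (2 * R * Real.pi) := by gcongr
            _ = _ := by ring
      _ = _ := by rw [← Finset.sum_mul, h1, one_mul]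
  have hB : ‖Complex.exp (-(v * θ ^ 2 / 2 : ℝ)) - (1 - (v * θ ^ 2 / 2 : ℝ))‖ ≤
      4 * R ^ 4 * Real.pi * Real.exp (2 * R ^ 2 * Real.pi ^ 2) * |θ| ^ 3 := by
    refine (norm_exp_neg_sub_le (by positivity)).trans ?_
    have hw : v * θ ^ 2 / 2 ≤ 2 * R ^ 2 * |θ| ^ 2 := by
      rw [sq_abs]
      nlinarith [sq_nonneg θ]
    have hw2 : v * θ ^ 2 / 2 ≤ 2 * R ^ 2 * Real.pi ^ 2 := hw.trans (by gcongr)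
    calc _ ≤ (2 * R ^ 2 * |θ| ^ 2) ^ 2 * Real.exp (2 * R ^ 2 * Real.pi ^ 2) := by gcongr
      _ = 4 * R ^ 4 * |θ| * Real.exp (2 * R ^ 2 * Real.pi ^ 2) * |θ| ^ 3 := by ring
      _ ≤ _ := by gcongr
  calc _ ≤ _ := norm_sub_le_norm_sub_add_norm_sub _ (1 - ((v * θ ^ 2 / 2 : ℝ) : ℂ)) _
    _ ≤ _ := by
      rw [norm_sub_rev (1 - ((v * θ ^ 2 / 2 : ℝ) : ℂ))]
      linarith

/-- On-diagonal upper bound for convolution powers. -/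
theorem convZPow_le_of_norm_charSum_le {S : Finset ℤ} {p : ℤ → ℝ} (hS : ∀ x ∉ S, p x = 0)
    {c : ℝ} (hc : 0 < c)
    (hφ : ∀ θ : ℝ, |θ| ≤ Real.pi → ‖charSum S p θ‖ ≤ Real.exp (-c * θ ^ 2))
    {n : ℕ} (hn : 0 < n) (x : ℤ) :
    convZPow p n x ≤ Real.sqrt (Real.pi / c) / Real.sqrt n := by
  have hpi := Real.pi_pos
  have hn' : (0 : ℝ) < n := by exact_mod_cast hn
  have hint := convZPow_eq_integral hS n x
  have h1 : ‖∫ θ in (-Real.pi)..Real.pi, charSum S p θ ^ n *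
      Complex.exp (-(θ * x * Complex.I))‖ ≤
      ∫ θ in (-Real.pi)..Real.pi, Real.exp (-(c * n) * θ ^ 2) := by
    refine intervalIntegral.norm_integral_le_of_norm_le (by linarith) ?_
      (Continuous.intervalIntegrable (by fun_prop) _ _)
    refine Filter.Eventually.of_forall fun θ hθ => ?_
    have he : ‖Complex.exp (-(θ * x * Complex.I))‖ = 1 := by
      rw [← neg_mul, show (-(θ * x) : ℂ) = ((-(θ * x) : ℝ) : ℂ) by push_cast; rfl,
        Complex.norm_exp_ofReal_mul_I]
    rw [norm_mul, he, mul_one, norm_pow]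
    calc ‖charSum S p θ‖ ^ n ≤ Real.exp (-c * θ ^ 2) ^ n := by
          gcongr
          exact hφ θ (abs_le.2 ⟨hθ.1.le, hθ.2⟩)
      _ = _ := by rw [← Real.exp_nat_mul]; ring_nf
  rw [← hint, norm_mul, Complex.norm_real] at h1
  have h2 : ‖(2 * Real.pi : ℂ)‖ = 2 * Real.pi := by
    simp [abs_of_pos hpi]
  rw [h2] at h1
  have h3 := integral_exp_neg_mul_sq_le_sqrt (mul_pos hc hn')
  rw [← div_div, Real.sqrt_div (div_pos hpi hc).le] at h3
  have h4 := le_abs_self (convZPow p n x)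
  rw [Real.norm_eq_abs] at h1
  have h5 := Real.pi_gt_three
  nlinarith [abs_nonneg (convZPow p n x)]

theorem le_integral_exp_neg_mul_sq {v : ℝ} (hv : 0 ≤ v) {n : ℕ} (hn : 0 < n) :
    2 * Real.exp (-(v / 2)) / Real.sqrt n ≤
      ∫ θ in (-Real.pi)..Real.pi, Real.exp (-(v * n / 2) * θ ^ 2) := by
  have hn' : (1 : ℝ) ≤ n := by exact_mod_cast hn
  have hs : 1 ≤ Real.sqrt n := Real.one_le_sqrt.2 hn'
  have hss : Real.sqrt n ^ 2 = n := Real.sq_sqrt (by linarith)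
  have hi : (Real.sqrt n)⁻¹ ≤ 1 := inv_le_one_of_one_le₀ hs
  have hi0 : 0 < (Real.sqrt n)⁻¹ := by positivity
  have hpi := Real.pi_gt_three
  have hint : ∀ a b : ℝ, IntervalIntegrable (fun θ : ℝ => Real.exp (-(v * n / 2) * θ ^ 2))
      MeasureTheory.volume a b := fun a b => Continuous.intervalIntegrable (by fun_prop) _ _
  calc 2 * Real.exp (-(v / 2)) / Real.sqrt n
      = ∫ _ in (-(Real.sqrt n)⁻¹)..(Real.sqrt n)⁻¹, Real.exp (-(v / 2)) := by
        rw [intervalIntegral.integral_const, smul_eq_mul]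
        ring
    _ ≤ ∫ θ in (-(Real.sqrt n)⁻¹)..(Real.sqrt n)⁻¹, Real.exp (-(v * n / 2) * θ ^ 2) := by
        refine intervalIntegral.integral_mono_on (by linarith) (by simp) (hint _ _) fun θ hθ => ?_
        have h1 : θ ^ 2 ≤ (Real.sqrt n)⁻¹ ^ 2 := sq_le_sq' hθ.1 hθ.2
        rw [inv_pow, hss] at h1
        have h2 : n * θ ^ 2 ≤ 1 := by
          calc n * θ ^ 2 ≤ n * (n : ℝ)⁻¹ := by gcongr
            _ = 1 := mul_inv_cancel₀ (by linarith)
        rw [Real.exp_le_exp]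
        nlinarith
    _ ≤ _ := by
        refine intervalIntegral.integral_mono_interval (by linarith) (by linarith) (by linarith)
          (Filter.Eventually.of_forall fun θ => (Real.exp_pos _).le) (hint _ _)

/-- Lower bound at the mean for convolution powers, uniform in the measure. -/
theorem exists_le_convZPow_at_mean (S : Finset ℤ) {R : ℝ} (hR : ∀ s ∈ S, |(s : ℝ)| ≤ R)
    {c : ℝ} (hc : 0 < c) :
    ∃ B > (0 : ℝ), ∃ N : ℕ, ∀ n : ℕ, N ≤ n → ∀ p : ℤ → ℝ, (∀ x ∉ S, p x = 0) → (∀ x, 0 ≤ p x) →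
      ∑ s ∈ S, p s = 1 → ∀ m : ℝ, ∑ s ∈ S, p s * s = m →
      2 * c ≤ ∑ s ∈ S, p s * ((s : ℝ) - m) ^ 2 →
      (∀ θ : ℝ, |θ| ≤ Real.pi → ‖charSum S p θ‖ ≤ Real.exp (-c * θ ^ 2)) →
      ∀ T : ℤ, n * m = T → B / Real.sqrt n ≤ convZPow p n T := by
  have hpi := Real.pi_pos
  set D := 8 * R ^ 3 * Real.exp (2 * R * Real.pi) +
    4 * R ^ 4 * Real.pi * Real.exp (2 * R ^ 2 * Real.pi ^ 2) with hD
  set E := 16 * D * Real.sqrt Real.pi / c ^ 2 with hE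
  refine ⟨Real.exp (-(2 * R ^ 2)) / (2 * Real.pi), by positivity,
    max 2 ⌈(E * Real.exp (2 * R ^ 2)) ^ 2⌉₊, ?_⟩
  intro n hn p hS h0 h1 m hm hv hφ T hT
  have hR0 := nonneg_of_sum_eq_one hR h1
  have hvR := variance_le hR h0 h1 hm
  have hclose := fun θ : ℝ => norm_charSum_sub_gaussian_le hR h0 h1 hm rfl (θ := θ)
  set v := ∑ s ∈ S, p s * ((s : ℝ) - m) ^ 2
  have hD0 : 0 ≤ D := by positivity
  have hE0 : 0 ≤ E := by positivity
  have hn2 : 2 ≤ n := (le_max_left _ _).trans hn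
  have hn2' : (2 : ℝ) ≤ n := by exact_mod_cast hn2
  have hs : 0 < Real.sqrt n := Real.sqrt_pos.2 (by linarith)
  have hss : Real.sqrt n * Real.sqrt n = n := Real.mul_self_sqrt (by linarith)
  have hnE : E * Real.exp (2 * R ^ 2) ≤ Real.sqrt n :=
    Real.le_sqrt_of_sq_le (Nat.ceil_le.1 ((le_max_right _ _).trans hn))
  have hcont := continuous_charSum S p
  set f : ℝ → ℂ := fun θ => charSum S p θ ^ n * Complex.exp (-(θ * T * Complex.I)) with hf
  set g : ℝ → ℝ := fun θ => Real.exp (-(v * n / 2) * θ ^ 2) with hg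
  have hfc : Continuous f := by fun_prop
  have hgc : Continuous fun θ => (g θ : ℂ) := by fun_prop
  have hfg : ∀ θ : ℝ, |θ| ≤ Real.pi →
      ‖f θ - g θ‖ ≤ n * D * (|θ| ^ 3 * Real.exp (-(2 * (c * n / 4)) * θ ^ 2)) := by
    intro θ hθ
    have hfa : f θ = (charSum S p θ * Complex.exp (-(θ * m * Complex.I))) ^ n := by
      rw [hf, mul_pow, ← Complex.exp_nat_mul]
      have : (n : ℂ) * m = T := by exact_mod_cast hT
      simp only [← this]
      ring_nf
    have hgb : (g θ : ℂ) = Complex.exp (-(v * θ ^ 2 / 2 : ℝ)) ^ n := by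
      rw [hg, ← Complex.exp_nat_mul]
      push_cast
      ring_nf
    have hr : ‖charSum S p θ * Complex.exp (-(θ * m * Complex.I))‖ ≤ Real.exp (-c * θ ^ 2) := by
      have he : ‖Complex.exp (-(θ * m * Complex.I))‖ = 1 := by
        rw [← neg_mul, show (-(θ * m) : ℂ) = ((-(θ * m) : ℝ) : ℂ) by push_cast; rfl,
          Complex.norm_exp_ofReal_mul_I]
      rw [norm_mul, he, mul_one]
      exact hφ θ hθ
    have hr' : ‖Complex.exp (-(v * θ ^ 2 / 2 : ℝ))‖ ≤ Real.exp (-c * θ ^ 2) := by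
      rw [← Complex.ofReal_neg, ← Complex.ofReal_exp, Complex.norm_real,
        Real.norm_of_nonneg (Real.exp_pos _).le, Real.exp_le_exp]
      nlinarith [sq_nonneg θ]
    obtain ⟨k, rfl⟩ : ∃ k, n = k + 1 := ⟨n - 1, by omega⟩
    rw [hfa, hgb]
    refine (norm_pow_succ_sub_pow_succ_le hr hr' k).trans ?_
    rw [← Real.exp_nat_mul]
    have h3 : Real.exp (k * (-c * θ ^ 2)) ≤
        Real.exp (-(2 * (c * ((k + 1 : ℕ) : ℝ) / 4)) * θ ^ 2) := by
      rw [Real.exp_le_exp]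
      push_cast at hn2' ⊢
      have : 0 ≤ c * θ ^ 2 := by positivity
      nlinarith
    have h4 := hclose θ hθ
    calc _ ≤ ((k : ℝ) + 1) * (D * |θ| ^ 3) *
          Real.exp (-(2 * (c * ((k + 1 : ℕ) : ℝ) / 4)) * θ ^ 2) := by gcongr
      _ = _ := by push_cast; ring
  have hκ : 0 < c * n / 4 := by positivity
  have hdiff : ‖(∫ θ in (-Real.pi)..Real.pi, f θ) - ∫ θ in (-Real.pi)..Real.pi, (g θ : ℂ)‖ ≤
      E / n := by
    rw [← intervalIntegral.integral_sub (hfc.intervalIntegrable _ _) (hgc.intervalIntegrable _ _)]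
    calc _ ≤ ∫ θ in (-Real.pi)..Real.pi,
          n * D * (|θ| ^ 3 * Real.exp (-(2 * (c * n / 4)) * θ ^ 2)) := by
          refine intervalIntegral.norm_integral_le_of_norm_le (by linarith)
            (Filter.Eventually.of_forall fun θ hθ => hfg θ (abs_le.2 ⟨hθ.1.le, hθ.2⟩))
            (Continuous.intervalIntegrable (by fun_prop) _ _)
      _ ≤ n * D * (Real.sqrt Real.pi / (c * n / 4) ^ 2) := by
          rw [intervalIntegral.integral_const_mul]
          gcongr
          exact integral_abs_pow_three_mul_exp_le hκ
      _ = E / n := by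
          rw [hE]
          field_simp
          norm_num
  rw [← convZPow_eq_integral hS n T, intervalIntegral.integral_ofReal] at hdiff
  have hre := (Complex.abs_re_le_norm _).trans hdiff
  rw [show (2 * Real.pi : ℂ) * (convZPow p n T : ℂ) = ((2 * Real.pi * convZPow p n T : ℝ) : ℂ) by
    push_cast; rfl, ← Complex.ofReal_sub, Complex.ofReal_re] at hre
  have hlow := le_integral_exp_neg_mul_sq (v := v) (by linarith) (n := n) (by omega)
  have hexp : Real.exp (-(2 * R ^ 2)) ≤ Real.exp (-(v / 2)) := by
    rw [Real.exp_le_exp]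
    linarith
  have hEn : E / n ≤ Real.exp (-(2 * R ^ 2)) / Real.sqrt n := by
    rw [show E / n = E / Real.sqrt n / Real.sqrt n by rw [div_div E (Real.sqrt n), hss], Real.exp_neg]
    gcongr
    rw [div_le_iff₀ hs, ← div_eq_inv_mul, le_div_iff₀ (Real.exp_pos _)]
    exact hnE
  have hmain : 2 * Real.exp (-(2 * R ^ 2)) / Real.sqrt n ≤
      2 * Real.exp (-(v / 2)) / Real.sqrt n := by gcongr
  have h5 := (abs_le.1 hre).1
  rw [mul_div_assoc] at hmain
  rw [div_div, mul_comm (2 * Real.pi), ← div_div, div_le_iff₀ (by positivity)]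
  linarith

theorem norm_charSum_sq (S : Finset ℤ) (p : ℤ → ℝ) (θ : ℝ) :
    ‖charSum S p θ‖ ^ 2 =
      ∑ x ∈ S, ∑ y ∈ S, p x * p y * Real.cos (θ * ((x : ℝ) - y)) := by
  have h : ∀ s : ℤ, Complex.exp (θ * s * Complex.I) =
      Complex.exp ((θ * s : ℝ) * Complex.I) := fun s => by push_cast; rfl
  have hre : (charSum S p θ).re = ∑ s ∈ S, p s * Real.cos (θ * s) := by
    rw [charSum, Complex.re_sum]
    refine Finset.sum_congr rfl fun s _ => ?_
    rw [Complex.re_ofReal_mul, h, Complex.exp_ofReal_mul_I_re]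
  have him : (charSum S p θ).im = ∑ s ∈ S, p s * Real.sin (θ * s) := by
    rw [charSum, Complex.im_sum]
    refine Finset.sum_congr rfl fun s _ => ?_
    rw [Complex.im_ofReal_mul, h, Complex.exp_ofReal_mul_I_im]
  rw [Complex.sq_norm, Complex.normSq_apply, hre, him, Finset.sum_mul_sum, Finset.sum_mul_sum,
    ← Finset.sum_add_distrib]
  refine Finset.sum_congr rfl fun x _ => ?_
  rw [← Finset.sum_add_distrib]
  refine Finset.sum_congr rfl fun y _ => ?_
  rw [mul_sub, Real.cos_sub]
  ring

theorem one_sub_norm_charSum_sq {S : Finset ℤ} {p : ℤ → ℝ} (h1 : ∑ s ∈ S, p s = 1) (θ : ℝ) :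
    1 - ‖charSum S p θ‖ ^ 2 =
      ∑ x ∈ S, ∑ y ∈ S, p x * p y * (1 - Real.cos (θ * ((x : ℝ) - y))) := by
  have h2 : (1 : ℝ) = ∑ x ∈ S, ∑ y ∈ S, p x * p y := by
    rw [← Finset.sum_mul_sum, h1, one_mul]
  rw [norm_charSum_sq]
  nth_rewrite 1 [h2]
  simp_rw [mul_sub, mul_one, Finset.sum_sub_distrib]

/-- If a character is constant on the support of `μ`, it is constant on that of `μ^{*n}`. -/
theorem exp_eq_pow_of_convZPow_ne_zero {S : Finset ℤ} {μ : ℤ → ℝ} (hS : ∀ x ∉ S, μ x = 0)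
    {θ : ℝ} {u : ℂ} (hu : ∀ s ∈ S, Complex.exp (θ * s * Complex.I) = u) (n : ℕ) (x : ℤ)
    (hx : convZPow μ n x ≠ 0) : Complex.exp (θ * x * Complex.I) = u ^ n := by
  induction n generalizing x with
  | zero =>
    have : x = 0 := by
      by_contra h
      simp [convZPow, h] at hx
    simp [this]
  | succ n ih =>
    rw [convZPow, convZ_eq_sum hS] at hx
    obtain ⟨y, hy, hne⟩ := Finset.exists_ne_zero_of_sum_ne_zero hx
    have h := ih (x - y) (right_ne_zero_of_mul hne)
    rw [pow_succ, ← h, ← hu y hy, ← Complex.exp_add]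
    push_cast
    ring_nf

theorem exp_mul_I_eq_one_of_cos_eq_one {t : ℝ} (h : Real.cos t = 1) :
    Complex.exp (t * Complex.I) = 1 := by
  have hs : Real.sin t = 0 := by
    have := Real.sin_sq_add_cos_sq t
    rw [h] at this
    nlinarith
  rw [Complex.exp_mul_I, ← Complex.ofReal_cos, ← Complex.ofReal_sin, h, hs]
  simp

/-- Aperiodicity and non-degeneracy: no nontrivial character is constant on the support. -/
theorem exists_cos_ne_one {S : Finset ℤ} {μ : ℤ → ℝ} (hS : ∀ x, x ∈ S ↔ μ x ≠ 0)
    (hsym : ∀ x : ℤ, μ x = μ (-x)) (hne : S.Nonempty) (hnondeg : NondegenerateZ μ)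
    (haper : AperiodicZ μ) {θ : ℝ} (hθ : |θ| ≤ Real.pi) (hθ0 : θ ≠ 0) :
    ∃ x ∈ S, ∃ y ∈ S, Real.cos (θ * ((x : ℝ) - y)) ≠ 1 := by
  by_contra! hcon
  obtain ⟨x₀, hx₀⟩ := hne
  set u : ℂ := Complex.exp (θ * x₀ * Complex.I) with hu_def
  have hu : ∀ s ∈ S, Complex.exp (θ * s * Complex.I) = u := by
    intro s hs
    have h := exp_mul_I_eq_one_of_cos_eq_one (hcon s hs x₀ hx₀)
    have h2 : (θ * s * Complex.I : ℂ) =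
        (θ * ((s : ℝ) - x₀) : ℝ) * Complex.I + θ * x₀ * Complex.I := by
      push_cast
      ring
    rw [h2, Complex.exp_add, h, one_mul]
  have hS0 : ∀ x ∉ S, μ x = 0 := fun x hx => by
    by_contra h
    exact hx ((hS x).2 h)
  have hu2 : u * u = 1 := by
    have hneg : -x₀ ∈ S := by
      rw [hS, ← hsym]
      exact (hS x₀).1 hx₀
    nth_rewrite 2 [← hu _ hneg]
    rw [hu_def, ← Complex.exp_add]
    push_cast
    ring_nf
    simp
  have hu1 : u = 1 := by
    rcases mul_self_eq_one_iff.1 hu2 with h | h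
    · exact h
    · exfalso
      have : (2 : ℕ) = 1 := haper 2 fun n _ hn => by
        have h3 := exp_eq_pow_of_convZPow_ne_zero hS0 hu n 0 hn.ne'
        rw [h] at h3
        simp only [Int.cast_zero, mul_zero, zero_mul, Complex.exp_zero] at h3
        have h4 : Even n := by
          by_contra hodd
          rw [(Nat.not_even_iff_odd.1 hodd).neg_one_pow] at h3
          norm_num at h3
        exact h4.two_dvd
      omega
  have hall : ∀ z : ℤ, Complex.exp (θ * z * Complex.I) = 1 := by
    intro z
    have hmem : z ∈ AddSubgroup.closure (Function.support μ) := by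
      rw [show AddSubgroup.closure (Function.support μ) = ⊤ from hnondeg]
      trivial
    induction hmem using AddSubgroup.closure_induction with
    | mem x hx => rw [hu x ((hS x).2 hx), hu1]
    | zero => simp
    | add x y _ _ hx hy =>
      push_cast
      rw [mul_add, add_mul, Complex.exp_add, hx, hy, one_mul]
    | neg x _ hx =>
      push_cast
      rw [mul_neg, neg_mul, Complex.exp_neg, hx, inv_one]
  have hcos : Real.cos θ = 1 := by
    have h := congrArg Complex.re (hall 1)
    rwa [Int.cast_one, mul_one, Complex.exp_ofReal_mul_I_re, Complex.one_re] at h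
  have hpi := Real.pi_pos
  rw [abs_le] at hθ
  exact hθ0 ((Real.cos_eq_one_iff_of_lt_of_lt (by linarith) (by linarith)).1 hcos)

/-- Quadratic lower bound for `1 - |φ|²` on `[-π, π]`. -/
theorem exists_mul_sq_le_sum_one_sub_cos {S : Finset ℤ} {μ : ℤ → ℝ} (hS : ∀ x, x ∈ S ↔ μ x ≠ 0)
    (hμ0 : ∀ x, 0 ≤ μ x) (hsym : ∀ x : ℤ, μ x = μ (-x)) {x₀ : ℤ} (hx₀ : x₀ ∈ S) (hx₀0 : x₀ ≠ 0)
    (hnondeg : NondegenerateZ μ) (haper : AperiodicZ μ) :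
    ∃ c > (0 : ℝ), ∀ θ : ℝ, |θ| ≤ Real.pi →
      c * θ ^ 2 ≤ ∑ x ∈ S, ∑ y ∈ S, μ x * μ y * (1 - Real.cos (θ * ((x : ℝ) - y))) := by
  have hpi := Real.pi_pos
  have hpos : ∀ x ∈ S, 0 < μ x := fun x hx => (hμ0 x).lt_of_ne' ((hS x).1 hx)
  have hneg : -x₀ ∈ S := by
    rw [hS, ← hsym]
    exact (hS x₀).1 hx₀
  set G : ℝ → ℝ := fun θ => ∑ x ∈ S, ∑ y ∈ S, μ x * μ y * (1 - Real.cos (θ * ((x : ℝ) - y)))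
    with hG
  have hterm : ∀ (θ : ℝ) (x y : ℤ), 0 ≤ μ x * μ y * (1 - Real.cos (θ * ((x : ℝ) - y))) :=
    fun θ x y => mul_nonneg (mul_nonneg (hμ0 x) (hμ0 y)) (sub_nonneg.2 (Real.cos_le_one _))
  have hle : ∀ (θ : ℝ), ∀ x ∈ S, ∀ y ∈ S,
      μ x * μ y * (1 - Real.cos (θ * ((x : ℝ) - y))) ≤ G θ := fun θ x hx y hy =>
    (Finset.single_le_sum (fun y _ => hterm θ x y) hy).trans
      (Finset.single_le_sum (f := fun x => ∑ y ∈ S,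
        μ x * μ y * (1 - Real.cos (θ * ((x : ℝ) - y))))
        (fun x _ => Finset.sum_nonneg fun y _ => hterm θ x y) hx)
  have hxabs : 0 < |(x₀ : ℝ)| := abs_pos.2 (by exact_mod_cast hx₀0)
  set δ := Real.pi / (2 * |(x₀ : ℝ)|) with hδ
  have hδ0 : 0 < δ := by positivity
  set K : Set ℝ := Metric.closedBall 0 Real.pi ∩ {θ | δ ≤ |θ|} with hK
  have hKc : IsCompact K := (isCompact_closedBall _ _).inter_right
    (isClosed_le continuous_const continuous_abs)
  have hGc : Continuous G := by fun_prop
  obtain ⟨g₀, hg₀, hmin⟩ := hKc.exists_forall_le' (a := 0) hGc.continuousOn (by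
    rintro θ ⟨h1, h2⟩
    rw [mem_closedBall_zero_iff, Real.norm_eq_abs] at h1
    obtain ⟨x, hx, y, hy, hne⟩ := exists_cos_ne_one hS hsym ⟨x₀, hx₀⟩ hnondeg haper h1
      (abs_pos.1 (hδ0.trans_le h2))
    refine lt_of_lt_of_le ?_ (hle θ x hx y hy)
    have : Real.cos (θ * ((x : ℝ) - y)) < 1 := (Real.cos_le_one _).lt_of_ne hne
    exact mul_pos (mul_pos (hpos x hx) (hpos y hy)) (by linarith))
  set c₁ := μ x₀ * μ (-x₀) * (2 / Real.pi ^ 2 * (2 * x₀) ^ 2) with hc₁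
  have hc₁0 : 0 < c₁ := by
    have := hpos _ hx₀
    have := hpos _ hneg
    have : (x₀ : ℝ) ≠ 0 := by exact_mod_cast hx₀0
    positivity
  refine ⟨min c₁ (g₀ / Real.pi ^ 2), lt_min hc₁0 (by positivity), fun θ hθ => ?_⟩
  rcases le_total |θ| δ with h | h
  · have h1 : |θ * ((x₀ : ℝ) - ((-x₀ : ℤ) : ℝ))| ≤ Real.pi := by
      have : θ * ((x₀ : ℝ) - ((-x₀ : ℤ) : ℝ)) = θ * (2 * x₀) := by push_cast; ring
      rw [this, abs_mul, abs_mul, abs_two]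
      calc |θ| * (2 * |(x₀ : ℝ)|) ≤ δ * (2 * |(x₀ : ℝ)|) := by gcongr
        _ = Real.pi := by rw [hδ]; field_simp
    have h2 := Real.cos_le_one_sub_mul_cos_sq h1
    refine le_trans ?_ (hle θ x₀ hx₀ (-x₀) hneg)
    calc min c₁ (g₀ / Real.pi ^ 2) * θ ^ 2 ≤ c₁ * θ ^ 2 := by
          gcongr
          exact min_le_left _ _
      _ = μ x₀ * μ (-x₀) * (2 / Real.pi ^ 2 * (θ * ((x₀ : ℝ) - ((-x₀ : ℤ) : ℝ))) ^ 2) := by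
          rw [hc₁]
          push_cast
          ring
      _ ≤ _ := mul_le_mul_of_nonneg_left (by linarith) (mul_nonneg (hμ0 _) (hμ0 _))
  · refine le_trans ?_ (hmin θ ⟨by rwa [mem_closedBall_zero_iff, Real.norm_eq_abs], h⟩)
    calc min c₁ (g₀ / Real.pi ^ 2) * θ ^ 2 ≤ g₀ / Real.pi ^ 2 * Real.pi ^ 2 := by
          rw [← sq_abs θ]
          gcongr
          exact min_le_right _ _
      _ = g₀ := by field_simp

/-- Uniform Gaussian decay of the characteristic function, and a uniform lower bound on the
variance, for all probability weights on `S` that dominate `κ μ`. -/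
theorem exists_uniform_charSum_bound {S : Finset ℤ} {μ : ℤ → ℝ} (hS : ∀ x, x ∈ S ↔ μ x ≠ 0)
    (hμ0 : ∀ x, 0 ≤ μ x) (hsym : ∀ x : ℤ, μ x = μ (-x)) {x₀ : ℤ} (hx₀ : x₀ ∈ S) (hx₀0 : x₀ ≠ 0)
    (hnondeg : NondegenerateZ μ) (haper : AperiodicZ μ) {κ : ℝ} (hκ : 0 < κ) :
    ∃ c > (0 : ℝ), ∀ p : ℤ → ℝ, (∀ x, 0 ≤ p x) → ∑ s ∈ S, p s = 1 →
      (∀ x ∈ S, κ * μ x ≤ p x) →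
      (∀ θ : ℝ, |θ| ≤ Real.pi → ‖charSum S p θ‖ ≤ Real.exp (-c * θ ^ 2)) ∧
      ∀ m : ℝ, 2 * c ≤ ∑ s ∈ S, p s * ((s : ℝ) - m) ^ 2 := by
  obtain ⟨c, hc, hbound⟩ := exists_mul_sq_le_sum_one_sub_cos hS hμ0 hsym hx₀ hx₀0 hnondeg haper
  have hμx : 0 < μ x₀ := (hμ0 x₀).lt_of_ne' ((hS x₀).1 hx₀)
  have hx0' : (x₀ : ℝ) ≠ 0 := by exact_mod_cast hx₀0
  refine ⟨min (κ ^ 2 * c / 2) (κ * μ x₀ * x₀ ^ 2), lt_min (by positivity) (by positivity), ?_⟩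
  intro p hp0 hp1 hpκ
  refine ⟨fun θ hθ => ?_, fun m => ?_⟩
  · have h1 : κ ^ 2 * (c * θ ^ 2) ≤ 1 - ‖charSum S p θ‖ ^ 2 := by
      rw [one_sub_norm_charSum_sq hp1]
      refine (mul_le_mul_of_nonneg_left (hbound θ hθ) (sq_nonneg κ)).trans ?_
      simp_rw [Finset.mul_sum]
      refine Finset.sum_le_sum fun x hx => Finset.sum_le_sum fun y hy => ?_
      rw [← mul_assoc]
      refine mul_le_mul_of_nonneg_right ?_ (by linarith [Real.cos_le_one (θ * ((x : ℝ) - y))])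
      calc κ ^ 2 * (μ x * μ y) = (κ * μ x) * (κ * μ y) := by ring
        _ ≤ p x * p y := mul_le_mul (hpκ x hx) (hpκ y hy) (mul_nonneg hκ.le (hμ0 y)) (hp0 x)
    refine (sq_le_sq₀ (norm_nonneg _) (Real.exp_pos _).le).1 ?_
    calc ‖charSum S p θ‖ ^ 2 ≤ -(κ ^ 2 * (c * θ ^ 2)) + 1 := by linarith
      _ ≤ Real.exp (-(κ ^ 2 * (c * θ ^ 2))) := Real.add_one_le_exp _
      _ ≤ Real.exp (2 * (-min (κ ^ 2 * c / 2) (κ * μ x₀ * x₀ ^ 2) * θ ^ 2)) := by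
          rw [Real.exp_le_exp]
          nlinarith [mul_le_mul_of_nonneg_right
            (min_le_left (κ ^ 2 * c / 2) (κ * μ x₀ * x₀ ^ 2)) (sq_nonneg θ)]
      _ = _ := by rw [← Real.exp_nat_mul]; norm_cast
  · have hneg : -x₀ ∈ S := by
      rw [hS, ← hsym]
      exact hμx.ne'
    have hne : x₀ ≠ -x₀ := by omega
    have hsub : ({x₀, -x₀} : Finset ℤ) ⊆ S := by
      intro x hx
      rcases Finset.mem_insert.1 hx with rfl | h
      · exact hx₀
      · rwa [Finset.mem_singleton.1 h]
    refine le_trans ?_ (Finset.sum_le_sum_of_subset_of_nonneg hsub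
      fun s _ _ => mul_nonneg (hp0 s) (sq_nonneg _))
    rw [Finset.sum_pair hne]
    have h1 := mul_le_mul_of_nonneg_right (hpκ x₀ hx₀) (sq_nonneg ((x₀ : ℝ) - m))
    have h2 := mul_le_mul_of_nonneg_right (hpκ (-x₀) hneg) (sq_nonneg (((-x₀ : ℤ) : ℝ) - m))
    rw [← hsym] at h2
    have h3 := min_le_right (κ ^ 2 * c / 2) (κ * μ x₀ * x₀ ^ 2)
    have h4 : κ * μ x₀ * ((x₀ : ℝ) - m) ^ 2 + κ * μ x₀ * (((-x₀ : ℤ) : ℝ) - m) ^ 2 =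
        2 * (κ * μ x₀ * x₀ ^ 2) + 2 * (κ * μ x₀ * m ^ 2) := by
      push_cast
      ring
    have h5 : 0 ≤ κ * μ x₀ * m ^ 2 := by positivity
    linarith

theorem exists_ne_zero_of_nondegenerateZ {μ : ℤ → ℝ} (h : NondegenerateZ μ) :
    ∃ x, x ≠ 0 ∧ μ x ≠ 0 := by
  by_contra! hcon
  have hsub : Function.support μ ⊆ ((⊥ : AddSubgroup ℤ) : Set ℤ) := by
    intro x hx
    by_contra h0
    exact hx (hcon x fun h => h0 (by simp [h]))
  have htop : AddSubgroup.closure (Function.support μ) = ⊤ := h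
  have hle := (AddSubgroup.closure_le _).2 hsub
  rw [htop] at hle
  have : (1 : ℤ) ∈ (⊥ : AddSubgroup ℤ) := hle trivial
  simp at this

theorem sum_mul_self_eq_zero_of_symm {S : Finset ℤ} {μ : ℤ → ℝ} (hS : ∀ x, x ∈ S ↔ μ x ≠ 0)
    (hsym : ∀ x : ℤ, μ x = μ (-x)) : ∑ s ∈ S, μ s * (s : ℝ) = 0 := by
  have h : ∑ s ∈ S, μ s * (s : ℝ) = ∑ s ∈ S, -(μ s * (s : ℝ)) := by
    refine Finset.sum_equiv (Equiv.neg ℤ) (fun s => ?_) fun s _ => ?_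
    · rw [Equiv.neg_apply, hS, hS, ← hsym]
    · rw [Equiv.neg_apply, ← hsym]
      push_cast
      ring
  rw [Finset.sum_neg_distrib] at h
  linarith

theorem mul_exp_sub_one_le {l s R : ℝ} (hl0 : 0 ≤ l) (hl1 : l ≤ 1) (hs : |s| ≤ R) :
    s * (Real.exp (l * s) - 1) ≤ R ^ 2 * Real.exp R * l := by
  have hR : 0 ≤ R := (abs_nonneg s).trans hs
  have hls : l * s ≤ R := by nlinarith [abs_le.1 hs, abs_nonneg s, le_abs_self s]
  have h1 : 1 ≤ Real.exp R := Real.one_le_exp hR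
  have h2 : s ^ 2 ≤ R ^ 2 := sq_le_sq' (abs_le.1 hs).1 (abs_le.1 hs).2
  have h3 : s * (Real.exp (l * s) - 1) ≤ s ^ 2 * Real.exp R * l := by
    rcases le_total 0 s with h | h
    · have h4 : Real.exp (l * s) - 1 ≤ l * s * Real.exp (l * s) := by
        have h5 := Real.add_one_le_exp (-(l * s))
        rw [Real.exp_neg] at h5
        have h6 := Real.exp_pos (l * s)
        have h7 := mul_le_mul_of_nonneg_right h5 h6.le
        rw [inv_mul_cancel₀ h6.ne'] at h7
        linarith
      have h8 : l * s * Real.exp (l * s) ≤ l * s * Real.exp R := by gcongr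
      calc s * (Real.exp (l * s) - 1) ≤ s * (l * s * Real.exp R) := by gcongr; linarith
        _ = _ := by ring
    · have h4 := Real.add_one_le_exp (l * s)
      have h5 : s * (Real.exp (l * s) - 1) ≤ s * (l * s) :=
        mul_le_mul_of_nonpos_left (by linarith) h
      have h6 : 0 ≤ s ^ 2 * l := by positivity
      nlinarith
  exact h3.trans (by gcongr)

/-- The exponential tilt of `μ` (supported on `S`) with parameter `l`. -/
noncomputable def expTilt (S : Finset ℤ) (μ : ℤ → ℝ) (l : ℝ) (x : ℤ) : ℝ :=
  μ x * Real.exp (l * x) / ∑ s ∈ S, μ s * Real.exp (l * s)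

section Tilt

variable {S : Finset ℤ} {μ : ℤ → ℝ} {R : ℝ}

theorem exp_mul_mem_Icc {l : ℝ} (hl0 : 0 ≤ l) (hl1 : l ≤ 1) {s : ℝ} (hs : |s| ≤ R) :
    Real.exp (l * s) ∈ Set.Icc (Real.exp (-R)) (Real.exp R) := by
  have h : |l * s| ≤ R := by
    rw [abs_mul, abs_of_nonneg hl0]
    nlinarith [abs_nonneg s]
  exact ⟨Real.exp_le_exp.2 (abs_le.1 h).1, Real.exp_le_exp.2 (abs_le.1 h).2⟩

theorem partition_mem_Icc (hR : ∀ s ∈ S, |(s : ℝ)| ≤ R) (hμ0 : ∀ x, 0 ≤ μ x)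
    (h1 : ∑ s ∈ S, μ s = 1) {l : ℝ} (hl0 : 0 ≤ l) (hl1 : l ≤ 1) :
    ∑ s ∈ S, μ s * Real.exp (l * s) ∈ Set.Icc (Real.exp (-R)) (Real.exp R) := by
  constructor
  · calc Real.exp (-R) = ∑ s ∈ S, μ s * Real.exp (-R) := by rw [← Finset.sum_mul, h1, one_mul]
      _ ≤ _ := Finset.sum_le_sum fun s hs =>
        mul_le_mul_of_nonneg_left (exp_mul_mem_Icc hl0 hl1 (hR s hs)).1 (hμ0 s)
  · calc _ ≤ ∑ s ∈ S, μ s * Real.exp R := Finset.sum_le_sum fun s hs =>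
        mul_le_mul_of_nonneg_left (exp_mul_mem_Icc hl0 hl1 (hR s hs)).2 (hμ0 s)
      _ = Real.exp R := by rw [← Finset.sum_mul, h1, one_mul]

theorem mul_le_expTilt (hR : ∀ s ∈ S, |(s : ℝ)| ≤ R) (hμ0 : ∀ x, 0 ≤ μ x)
    (h1 : ∑ s ∈ S, μ s = 1) {l : ℝ} (hl0 : 0 ≤ l) (hl1 : l ≤ 1) :
    ∀ x ∈ S, Real.exp (-(2 * R)) * μ x ≤ expTilt S μ l x := by
  intro x hx
  have hZ := partition_mem_Icc hR hμ0 h1 hl0 hl1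
  have hx' := exp_mul_mem_Icc hl0 hl1 (hR x hx)
  have hZ0 := (Real.exp_pos _).trans_le hZ.1
  rw [expTilt, le_div_iff₀ hZ0]
  calc _ ≤ Real.exp (-(2 * R)) * μ x * Real.exp R :=
        mul_le_mul_of_nonneg_left hZ.2 (mul_nonneg (Real.exp_pos _).le (hμ0 x))
    _ = μ x * Real.exp (-R) := by
        rw [mul_right_comm, ← Real.exp_add]
        ring_nf
    _ ≤ _ := mul_le_mul_of_nonneg_left hx'.1 (hμ0 x)

theorem sum_expTilt (hR : ∀ s ∈ S, |(s : ℝ)| ≤ R) (hμ0 : ∀ x, 0 ≤ μ x)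
    (h1 : ∑ s ∈ S, μ s = 1) {l : ℝ} (hl0 : 0 ≤ l) (hl1 : l ≤ 1) :
    ∑ s ∈ S, expTilt S μ l s = 1 := by
  have hZ0 := (Real.exp_pos _).trans_le (partition_mem_Icc hR hμ0 h1 hl0 hl1).1
  simp only [expTilt]
  rw [← Finset.sum_div, div_self hZ0.ne']

theorem sum_expTilt_mul_le (hS : ∀ x, x ∈ S ↔ μ x ≠ 0) (hsym : ∀ x : ℤ, μ x = μ (-x))
    (hR : ∀ s ∈ S, |(s : ℝ)| ≤ R) (hμ0 : ∀ x, 0 ≤ μ x)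
    (h1 : ∑ s ∈ S, μ s = 1) {l : ℝ} (hl0 : 0 ≤ l) (hl1 : l ≤ 1) :
    ∑ s ∈ S, expTilt S μ l s * s ≤ R ^ 2 * Real.exp (2 * R) * l := by
  have hZ := partition_mem_Icc hR hμ0 h1 hl0 hl1
  have hZ0 := (Real.exp_pos _).trans_le hZ.1
  have hW : ∑ s ∈ S, μ s * Real.exp (l * s) * s ≤ R ^ 2 * Real.exp R * l := by
    calc ∑ s ∈ S, μ s * Real.exp (l * s) * s
        = ∑ s ∈ S, μ s * (s * (Real.exp (l * s) - 1)) + ∑ s ∈ S, μ s * (s : ℝ) := by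
          rw [← Finset.sum_add_distrib]
          exact Finset.sum_congr rfl fun s _ => by ring
      _ ≤ ∑ s ∈ S, μ s * (R ^ 2 * Real.exp R * l) := by
          rw [sum_mul_self_eq_zero_of_symm hS hsym, add_zero]
          exact Finset.sum_le_sum fun s hs =>
            mul_le_mul_of_nonneg_left (mul_exp_sub_one_le hl0 hl1 (hR s hs)) (hμ0 s)
      _ = _ := by rw [← Finset.sum_mul, h1, one_mul]
  simp only [expTilt, div_mul_eq_mul_div]
  rw [← Finset.sum_div, div_le_iff₀ hZ0]
  calc _ ≤ R ^ 2 * Real.exp R * l := hW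
    _ = R ^ 2 * Real.exp (2 * R) * l * Real.exp (-R) := by
        rw [show Real.exp R = Real.exp (2 * R) * Real.exp (-R) by
          rw [← Real.exp_add]; ring_nf]
        ring
    _ ≤ _ := mul_le_mul_of_nonneg_left hZ.1 (by positivity)

theorem sum_expTilt_one_mul_pos (hS : ∀ x, x ∈ S ↔ μ x ≠ 0) (hsym : ∀ x : ℤ, μ x = μ (-x))
    (hR : ∀ s ∈ S, |(s : ℝ)| ≤ R) (hμ0 : ∀ x, 0 ≤ μ x)
    (h1 : ∑ s ∈ S, μ s = 1) {x₀ : ℤ} (hx₀ : x₀ ∈ S) (hx₀0 : x₀ ≠ 0) :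
    0 < ∑ s ∈ S, expTilt S μ 1 s * s := by
  have hZ0 := (Real.exp_pos _).trans_le (partition_mem_Icc hR hμ0 h1 zero_le_one le_rfl).1
  simp only [expTilt, div_mul_eq_mul_div]
  rw [← Finset.sum_div]
  refine div_pos ?_ hZ0
  have hpos : ∀ s : ℤ, s ≠ 0 → 0 < (s : ℝ) * (Real.exp (1 * s) - 1) := by
    intro s hs
    rw [one_mul]
    rcases lt_or_gt_of_ne hs with h | h
    · have h' : (s : ℝ) < 0 := by exact_mod_cast h
      exact mul_pos_of_neg_of_neg h' (by linarith [Real.exp_lt_one_iff.2 h'])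
    · have h' : 0 < (s : ℝ) := by exact_mod_cast h
      exact mul_pos h' (by linarith [Real.one_lt_exp_iff.2 h'])
  have hW : ∑ s ∈ S, μ s * Real.exp (1 * s) * s =
      ∑ s ∈ S, μ s * (s * (Real.exp (1 * s) - 1)) := by
    rw [← add_zero (∑ s ∈ S, μ s * (s * (Real.exp (1 * s) - 1))),
      ← sum_mul_self_eq_zero_of_symm hS hsym, ← Finset.sum_add_distrib]
    exact Finset.sum_congr rfl fun s _ => by ring
  rw [hW]
  refine Finset.sum_pos' (fun s _ => mul_nonneg (hμ0 s) ?_) ⟨x₀, hx₀, ?_⟩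
  · rcases eq_or_ne s 0 with rfl | h
    · simp
    · exact (hpos s h).le
  · exact mul_pos ((hμ0 x₀).lt_of_ne' ((hS x₀).1 hx₀)) (hpos x₀ hx₀0)

/-- Every mean between `0` and that of the unit tilt is attained by some tilt. -/
theorem exists_expTilt_mean_eq (hS : ∀ x, x ∈ S ↔ μ x ≠ 0) (hsym : ∀ x : ℤ, μ x = μ (-x))
    (hR : ∀ s ∈ S, |(s : ℝ)| ≤ R) (hμ0 : ∀ x, 0 ≤ μ x)
    (h1 : ∑ s ∈ S, μ s = 1) {a : ℝ} (ha0 : 0 ≤ a) (ha : a ≤ ∑ s ∈ S, expTilt S μ 1 s * s) :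
    ∃ l : ℝ, 0 ≤ l ∧ l ≤ 1 ∧ ∑ s ∈ S, expTilt S μ l s * s = a := by
  have hcont : ContinuousOn (fun l => ∑ s ∈ S, expTilt S μ l s * s) (Set.Icc 0 1) := by
    unfold expTilt
    refine continuousOn_finsetSum _ fun s _ => ContinuousOn.mul (ContinuousOn.div
      (by fun_prop) (by fun_prop) fun l hl => ?_) continuousOn_const
    exact ((Real.exp_pos _).trans_le (partition_mem_Icc hR hμ0 h1 hl.1 hl.2).1).ne'
  have hzero : ∑ s ∈ S, expTilt S μ 0 s * s = 0 := by
    simp [expTilt, h1, sum_mul_self_eq_zero_of_symm hS hsym]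
  obtain ⟨l, hl, hla⟩ := intermediate_value_Icc zero_le_one hcont ⟨hzero.trans_le ha0, ha⟩
  exact ⟨l, hl.1, hl.2, hla⟩

end Tilt

/-- For a symmetric, finitely supported, non-degenerate, aperiodic random walk on `ℤ`: for every
`ε > 0` there is `K > 0` such that for all large `n` and all integers `T` with
`√n ≤ T ≤ n^{2/3}`, `μ^{*n}(T + ⌊K n / T⌋) ≤ ε μ^{*n}(T)`. -/
theorem stmt17 (μ : ℤ → ℝ) (hμ0 : ∀ x, 0 ≤ μ x) (hμ1 : HasSum μ 1)
    (hsym : ∀ x : ℤ, μ x = μ (-x))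
    (hfin : (Function.support μ).Finite)
    (hnondeg : NondegenerateZ μ)
    (haper : AperiodicZ μ) :
    ∀ ε > (0 : ℝ), ∃ K > (0 : ℝ), ∃ N : ℕ, ∀ n : ℕ, N ≤ n → ∀ T : ℤ,
      Real.sqrt n ≤ (T : ℝ) → (T : ℝ) ≤ (n : ℝ) ^ ((2 : ℝ) / 3) →
      convZPow μ n (T + ⌊K * (n : ℝ) / (T : ℝ)⌋) ≤ ε * convZPow μ n T := by
  intro ε hε
  set S : Finset ℤ := hfin.toFinset with hSdef
  have hS : ∀ x, x ∈ S ↔ μ x ≠ 0 := fun x => by simp [hSdef]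
  have hS0 : ∀ x ∉ S, μ x = 0 := fun x hx => not_not.1 fun h => hx ((hS x).2 h)
  have h1 : ∑ s ∈ S, μ s = 1 := (hasSum_sum_of_ne_finset_zero hS0).unique hμ1
  set R : ℝ := ∑ s ∈ S, |(s : ℝ)| with hRdef
  have hR : ∀ s ∈ S, |(s : ℝ)| ≤ R := fun s hs =>
    Finset.single_le_sum (f := fun s : ℤ => |(s : ℝ)|) (fun s _ => abs_nonneg _) hs
  obtain ⟨x₀, hx₀0, hx₀'⟩ := exists_ne_zero_of_nondegenerateZ hnondeg
  have hx₀ : x₀ ∈ S := (hS x₀).2 hx₀'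
  obtain ⟨c, hc, hunif⟩ := exists_uniform_charSum_bound hS hμ0 hsym hx₀ hx₀0 hnondeg haper
    (Real.exp_pos (-(2 * R)))
  obtain ⟨B, hB, N₁, hlower⟩ := exists_le_convZPow_at_mean S hR hc
  set A := Real.sqrt (Real.pi / c) with hA
  have hA0 : 0 < A := Real.sqrt_pos.2 (div_pos Real.pi_pos hc)
  have hmean := sum_expTilt_one_mul_pos hS hsym hR hμ0 h1 hx₀ hx₀0
  set C := R ^ 2 * Real.exp (2 * R) + 1 with hC
  have hC0 : 0 < C := by positivity
  obtain ⟨N₂, hN₂⟩ : ∃ N₂ : ℕ, ∀ n : ℕ, N₂ ≤ n →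
      (n : ℝ) ^ (-(1 / 3 : ℝ)) ≤ ∑ s ∈ S, expTilt S μ 1 s * s := by
    have h := ((tendsto_rpow_neg_atTop (y := (1 / 3 : ℝ)) (by norm_num)).comp
      tendsto_natCast_atTop_atTop).eventually (eventually_le_nhds hmean)
    exact Filter.eventually_atTop.1 h
  refine ⟨C * (1 + |Real.log (ε * B / A)|), by positivity, max 1 (max N₁ N₂), ?_⟩
  set L := |Real.log (ε * B / A)| with hL
  intro n hn T hT1 hT2
  have hn1 : 1 ≤ n := (le_max_left _ _).trans hn
  have hnN₁ : N₁ ≤ n := (le_max_left _ _).trans ((le_max_right _ _).trans hn)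
  have hnN₂ : N₂ ≤ n := (le_max_right _ _).trans ((le_max_right _ _).trans hn)
  have hn0 : (0 : ℝ) < n := by exact_mod_cast hn1
  have hsn : 0 < Real.sqrt n := Real.sqrt_pos.2 hn0
  have hT0 : (0 : ℝ) < T := hsn.trans_le hT1
  have hTn : (T : ℝ) / n ≤ ∑ s ∈ S, expTilt S μ 1 s * s := by
    refine le_trans ?_ (hN₂ n hnN₂)
    rw [div_le_iff₀ hn0]
    refine hT2.trans_eq ?_
    nth_rewrite 3 [← Real.rpow_one (n : ℝ)]
    rw [← Real.rpow_add hn0]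
    norm_num
  obtain ⟨l, hl0, hl1, hl⟩ := exists_expTilt_mean_eq hS hsym hR hμ0 h1 (by positivity) hTn
  have hlC : (T : ℝ) / n ≤ C * l := by
    rw [← hl]
    refine (sum_expTilt_mul_le hS hsym hR hμ0 h1 hl0 hl1).trans ?_
    rw [hC]
    nlinarith
  set Z := ∑ s ∈ S, μ s * Real.exp (l * s) with hZ
  have hZ0 : 0 < Z := (Real.exp_pos _).trans_le (partition_mem_Icc hR hμ0 h1 hl0 hl1).1
  have hp0 : ∀ x, 0 ≤ expTilt S μ l x := fun x =>
    div_nonneg (mul_nonneg (hμ0 x) (Real.exp_pos _).le) hZ0.le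
  have hpS : ∀ x ∉ S, expTilt S μ l x = 0 := fun x hx => by simp [expTilt, hS0 x hx]
  have hp1 := sum_expTilt hR hμ0 h1 hl0 hl1
  obtain ⟨hφ, hvar⟩ := hunif _ hp0 hp1 (mul_le_expTilt hR hμ0 h1 hl0 hl1)
  have hlow := hlower n hnN₁ _ hpS hp0 hp1 _ hl (hvar _) hφ T (mul_div_cancel₀ _ hn0.ne')
  set m : ℤ := ⌊C * (1 + L) * (n : ℝ) / (T : ℝ)⌋ with hm
  have hup := convZPow_le_of_norm_charSum_le hpS hc hφ hn1 (T + m)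
  have htilt : ∀ x : ℤ, convZPow (expTilt S μ l) n x =
      Real.exp (l * x) / Z ^ n * convZPow μ n x := convZPow_tilt hS0 l Z n
  rw [htilt] at hlow hup
  have hlm : L ≤ l * m := by
    have h2 : C * (1 + L) * (n : ℝ) / (T : ℝ) - 1 < m := Int.sub_one_lt_floor _
    have h3 : 1 + L ≤ l * (C * (1 + L) * (n : ℝ) / (T : ℝ)) := by
      rw [div_le_iff₀ hn0] at hlC
      rw [← mul_div_assoc, le_div_iff₀ hT0]
      have : 0 ≤ 1 + L := by positivity
      nlinarith
    nlinarith
  have hexp : Real.exp (-(l * m)) * A ≤ ε * B := by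
    have hq : 0 < ε * B / A := by positivity
    have h2 : Real.exp (-(l * m)) ≤ ε * B / A := by
      rw [← Real.exp_log hq, Real.exp_le_exp]
      linarith [neg_abs_le (Real.log (ε * B / A))]
    rwa [le_div_iff₀ hA0] at h2
  have hZn : 0 < Z ^ n := pow_pos hZ0 n
  have hTm : Real.exp (l * ((T + m : ℤ) : ℝ)) = Real.exp (l * T) * Real.exp (l * m) := by
    rw [← Real.exp_add]
    push_cast
    ring_nf
  rw [hTm] at hup
  set w := Real.exp (l * T) / Z ^ n with hw
  have hw0 : 0 < w := by positivity
  have hup' : w * convZPow μ n (T + m) ≤ Real.exp (-(l * m)) * A / Real.sqrt n := by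
    calc w * convZPow μ n (T + m)
        = Real.exp (-(l * m)) *
          (Real.exp (l * T) * Real.exp (l * m) / Z ^ n * convZPow μ n (T + m)) := by
          rw [hw, Real.exp_neg]
          field_simp
      _ ≤ Real.exp (-(l * m)) * (A / Real.sqrt n) := by gcongr
      _ = _ := by ring
  refine le_of_mul_le_mul_left ?_ hw0
  calc w * convZPow μ n (T + m) ≤ Real.exp (-(l * m)) * A / Real.sqrt n := hup'
    _ ≤ ε * B / Real.sqrt n := by gcongr
    _ = ε * (B / Real.sqrt n) := by ring
    _ ≤ ε * (w * convZPow μ n T) := by gcongr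
    _ = w * (ε * convZPow μ n T) := by ring
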